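/- arXiv:2009.14080 — 2 statements merged into one kernel-verified Lean document; each statement's English description precedes it below -/
import Mathlib

section
/- Let G be a finite group with trivial multiplier acting as above, and define on the dilation space spanned by {|O,g'⟩} the operators V(g) := ∑_O ∑_{g'∈G} |O,gg'⟩⟨O,g'|. Then V is a unitary representation of G, V(g)J = JU(g) for the operator J := ∑_O (#H_O)^{-1/2} ∑_{g'} |O,g'⟩⟨d_O|U(g')*, and the canonical PVM Q_{O,g} = |O,g⟩⟨O,g| is covariant: Q_{O,gg'} = V(g) Q_{O,g'} V(g)* for all g, g' ∈ G. -/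
open ContinuousLinearMap
noncomputable section

/-- The rank-one operator `|u⟩⟨v|` on Euclidean space. -/
def ketbra {ι : Type*} [Fintype ι] [DecidableEq ι] (u v : EuclideanSpace ℂ ι) :
    EuclideanSpace ℂ ι →L[ℂ] EuclideanSpace ℂ ι :=
  (innerSL ℂ v).smulRight u

theorem ketbra_apply {ι : Type*} [Fintype ι] [DecidableEq ι] (u v x : EuclideanSpace ℂ ι) :
    ketbra u v x = inner ℂ v x • u := rfl

/-- Conjugating a rank-one operator transports its two vectors. -/
theorem comp_ketbra_comp_adjoint {ι : Type*} [Fintype ι] [DecidableEq ι]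
    (A B : EuclideanSpace ℂ ι →L[ℂ] EuclideanSpace ℂ ι) (u v : EuclideanSpace ℂ ι) :
    A ∘L ketbra u v ∘L adjoint B = ketbra (A u) (B v) := by
  ext1 x
  simp [ketbra_apply, adjoint_inner_right]

/-- The operator `∑ i, |σ i⟩⟨i|` of a permutation `σ` permutes coordinates by `σ⁻¹`. -/
theorem sum_ketbra_single_apply {ι : Type*} [Fintype ι] [DecidableEq ι] (σ : Equiv.Perm ι)
    (x : EuclideanSpace ℂ ι) (i : ι) :
    (∑ j, ketbra (EuclideanSpace.single (σ j) (1 : ℂ)) (EuclideanSpace.single j (1 : ℂ))) x i =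
      x (σ.symm i) := by
  simp [ketbra_apply, EuclideanSpace.inner_single_left,
    Pi.single_apply, ← Equiv.symm_apply_eq]

/-- With trivial multiplier, `V(g) := ∑_{O,g'} |O,gg'⟩⟨O,g'|` is a
unitary representation on the dilation space, `V(g) J = J U(g)`, and the canonical
PVM `Q_{O,g} = |O,g⟩⟨O,g|` is covariant: `Q_{O,gg'} = V(g) Q_{O,g'} V(g)*`. -/
theorem dilation_space_representation
    {G H Orb : Type*} [Group G] [Fintype G] [DecidableEq G]
    [Fintype Orb] [DecidableEq Orb]
    [NormedAddCommGroup H] [InnerProductSpace ℂ H] [FiniteDimensional ℂ H]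
    (U : G → (H →L[ℂ] H))
    (hUhom : ∀ g g', U (g * g') = U g ∘L U g')
    (hUnit : ∀ g, adjoint (U g) ∘L U g = 1 ∧ U g ∘L adjoint (U g) = 1)
    (HO : Orb → Subgroup G) (d : Orb → H)
    (hinv : ∀ (O : Orb) (h : G), h ∈ HO O → U h (d O) = d O)
    (J : H →L[ℂ] EuclideanSpace ℂ (Orb × G))
    (hJ : J = ∑ p : Orb × G,
      ((Real.sqrt (Nat.card (HO p.1)) : ℂ))⁻¹ •
        (((innerSL ℂ (d p.1)).comp (adjoint (U p.2))).smulRight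
          (EuclideanSpace.single p (1 : ℂ))))
    (V : G → (EuclideanSpace ℂ (Orb × G) →L[ℂ] EuclideanSpace ℂ (Orb × G)))
    (hV : ∀ g, V g = ∑ p : Orb × G,
      ketbra (EuclideanSpace.single (p.1, g * p.2) (1 : ℂ))
        (EuclideanSpace.single p (1 : ℂ))) :
    (∀ g g' : G, V (g * g') = V g ∘L V g') ∧
    (∀ g : G, adjoint (V g) ∘L V g = 1 ∧ V g ∘L adjoint (V g) = 1) ∧
    (∀ g : G, V g ∘L J = J ∘L U g) ∧
    (∀ (g g' : G) (O : Orb),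
      ketbra (EuclideanSpace.single (O, g * g') (1 : ℂ))
          (EuclideanSpace.single (O, g * g') (1 : ℂ)) =
        V g ∘L ketbra (EuclideanSpace.single (O, g') (1 : ℂ))
            (EuclideanSpace.single (O, g') (1 : ℂ)) ∘L adjoint (V g)) := by
  have hVapply (g : G) (x : EuclideanSpace ℂ (Orb × G)) (p : Orb × G) :
      V g x p = x (p.1, g⁻¹ * p.2) := by
    rw [hV]
    exact sum_ketbra_single_apply ((Equiv.refl Orb).prodCongr (Equiv.mulLeft g)) x p
  have hVmul (g g' : G) : V (g * g') = V g ∘L V g' := by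
    ext x p
    simp [hVapply, mul_assoc]
  have hVone : V 1 = 1 := by
    ext x p
    simp [hVapply]
  have hVadjoint (g : G) : adjoint (V g) = V g⁻¹ := by
    refine ((eq_adjoint_iff _ _).2 fun x y => ?_).symm
    simp only [PiLp.inner_apply, hVapply]
    refine Fintype.sum_equiv ((Equiv.refl Orb).prodCongr (Equiv.mulLeft g)) _ _ fun p => ?_
    simp [Prod.map]
  have hVsingle (g g' : G) (O : Orb) :
      V g (EuclideanSpace.single (O, g') (1 : ℂ)) = EuclideanSpace.single (O, g * g') 1 := by
    ext p
    simp [hVapply, Prod.ext_iff, inv_mul_eq_iff_eq_mul]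
  have hJapply (x : H) (p : Orb × G) :
      J x p = ((Real.sqrt (Nat.card (HO p.1)) : ℂ))⁻¹ * inner ℂ (U p.2 (d p.1)) x := by
    simp [hJ, adjoint_inner_right, Pi.single_apply]
  have hUinner (g : G) (x y : H) : inner ℂ (U g x) (U g y) = inner ℂ x y := by
    rw [← adjoint_inner_right, ← comp_apply, (hUnit g).1, one_apply_eq_self]
  refine ⟨hVmul, fun g => ?_, fun g => ?_, fun g g' O => ?_⟩
  · simp [hVadjoint, ← hVmul, hVone]
  · ext x p
    have hU : U p.2 (d p.1) = U g (U (g⁻¹ * p.2) (d p.1)) := by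
      rw [← comp_apply, ← hUhom, mul_inv_cancel_left]
    rw [comp_apply, comp_apply, hVapply, hJapply, hJapply, hU, hUinner]
  · rw [comp_ketbra_comp_adjoint, hVsingle]
end
end

section
/- With U the permutation representation of S_D on ℂ^D, d_O := |1⟩, d_{O'}(α) := α(e^{−iπ/8}|1⟩ + e^{iπ/8}|2⟩) for α ≥ 0, the normalization operator K(α) := (1/#H_O)∑_{π∈S_D} U(π)|1⟩⟨1|U(π)* + (1/#H_{O'})∑_{π∈S_D} U(π)|d_{O'}(α)⟩⟨d_{O'}(α)|U(π)* equals [(2D−2−√2)α² + 1]·(1 − |ψ₀⟩⟨ψ₀|) + [(2+√2)(D−1)α² + 1]·|ψ₀⟩⟨ψ₀|, where ψ₀ = D^{−1/2}(|1⟩+⋯+|D⟩). In particular K(α) is positive and invertible for all α ≥ 0. -/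
open ContinuousLinearMap
noncomputable section

/-- The permutation representation of `S_D` on `ℂ^D`: `U(π)|n⟩ = |π(n)⟩`. -/
def permU (D : ℕ) (π : Equiv.Perm (Fin D)) :
    EuclideanSpace ℂ (Fin D) →L[ℂ] EuclideanSpace ℂ (Fin D) :=
  ∑ n : Fin D,
    (innerSL ℂ (EuclideanSpace.single n (1 : ℂ))).smulRight
      (EuclideanSpace.single (π n) (1 : ℂ))

/-- The rank-one operator `|v⟩⟨v|` on `ℂ^D`. -/
def projD (D : ℕ) (v : EuclideanSpace ℂ (Fin D)) :
    EuclideanSpace ℂ (Fin D) →L[ℂ] EuclideanSpace ℂ (Fin D) :=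
  (innerSL ℂ v).smulRight v

open InnerProductSpace

/-- Summing over all permutations a function of the image of `0`. -/
theorem sum_perm_apply_zero {M : Type*} [AddCommMonoid M] (n : ℕ) (f : Fin (n + 1) → M) :
    ∑ π : Equiv.Perm (Fin (n + 1)), f (π 0) = n.factorial • ∑ i, f i := by
  rw [← Equiv.Perm.decomposeFin.symm.sum_comp, Fintype.sum_prod_type]
  simp [Fintype.card_perm, Finset.smul_sum]

/-- Summing over all permutations a function of the images of `0` and `1`. -/
theorem sum_perm_apply_zero_one {M : Type*} [AddCommGroup M] (n : ℕ)
    (f : Fin (n + 2) → Fin (n + 2) → M) :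
    ∑ π : Equiv.Perm (Fin (n + 2)), f (π 0) (π 1) =
      n.factorial • (∑ i, ∑ j, f i j - ∑ i, f i i) := by
  rw [← Equiv.Perm.decomposeFin.symm.sum_comp, Fintype.sum_prod_type, ← Finset.sum_sub_distrib,
    Finset.smul_sum]
  refine Finset.sum_congr rfl fun p _ => ?_
  simp only [Equiv.Perm.decomposeFin_symm_apply_zero, Equiv.Perm.decomposeFin_symm_apply_one]
  rw [sum_perm_apply_zero n fun q => f p (Equiv.swap 0 p q.succ),
    ← Equiv.sum_comp (Equiv.swap 0 p) (f p), Fin.sum_univ_succ fun j => f p (Equiv.swap 0 p j),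
    Equiv.swap_apply_left, add_sub_cancel_left]

theorem projD_eq_rankOne (D : ℕ) (v : EuclideanSpace ℂ (Fin D)) :
    projD D v = rankOne ℂ v v := rfl

theorem permU_single (D : ℕ) (π : Equiv.Perm (Fin D)) (i : Fin D) :
    permU D π (EuclideanSpace.single i 1) = EuclideanSpace.single (π i) 1 := by
  simp [permU, EuclideanSpace.inner_single_left]

theorem permU_conj_projD (D : ℕ) (π : Equiv.Perm (Fin D)) (v : EuclideanSpace ℂ (Fin D)) :
    permU D π ∘L projD D v ∘L adjoint (permU D π) =
      rankOne ℂ (permU D π v) (permU D π v) := by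
  rw [projD_eq_rankOne, rankOne_comp, comp_rankOne, adjoint_adjoint]

theorem sum_rankOne_single (D : ℕ) :
    ∑ i : Fin D, rankOne ℂ (EuclideanSpace.single i (1 : ℂ)) (EuclideanSpace.single i (1 : ℂ)) =
      1 := by
  ext w k
  simp [EuclideanSpace.inner_single_left, Pi.single_apply]

/-- A combination of complementary star projections with positive coefficients is positive and
invertible. -/
theorem isPositive_and_isUnit_of_isStarProjection {E : Type*} [NormedAddCommGroup E]
    [InnerProductSpace ℂ E] [CompleteSpace E] {P : E →L[ℂ] E} (hP : IsStarProjection P)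
    {a b : ℝ} (ha : 0 < a) (hb : 0 < b) :
    ((a : ℂ) • (1 - P) + (b : ℂ) • P).IsPositive ∧ IsUnit ((a : ℂ) • (1 - P) + (b : ℂ) • P) := by
  have ha' : (a : ℂ) ≠ 0 := by exact_mod_cast ha.ne'
  have hb' : (b : ℂ) ≠ 0 := by exact_mod_cast hb.ne'
  refine ⟨((IsPositive.of_isStarProjection hP.one_sub).smul_of_nonneg
    (by exact_mod_cast ha.le)).add ((IsPositive.of_isStarProjection hP).smul_of_nonneg
    (by exact_mod_cast hb.le)), ?_⟩
  refine isUnit_iff_exists.mpr ⟨(a : ℂ)⁻¹ • (1 - P) + (b : ℂ)⁻¹ • P, ?_, ?_⟩ <;>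
  simp only [add_mul, mul_add, smul_mul_smul_comm, mul_inv_cancel₀ ha', mul_inv_cancel₀ hb',
    inv_mul_cancel₀ ha', inv_mul_cancel₀ hb', hP.mul_one_sub_self, hP.one_sub_mul_self,
    hP.isIdempotentElem.eq, hP.one_sub.isIdempotentElem.eq, smul_zero, one_smul, add_zero,
    zero_add, sub_add_cancel]

/-- The uniform unit vector spans the averaging projection. -/
theorem rankOne_sum_single (D : ℕ) (hD : D ≠ 0) (ψ : EuclideanSpace ℂ (Fin D))
    (hψ : ψ = ((Real.sqrt D : ℂ))⁻¹ • ∑ n : Fin D, EuclideanSpace.single n (1 : ℂ)) :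
    ∑ i : Fin D, ∑ j : Fin D,
      rankOne ℂ (EuclideanSpace.single i (1 : ℂ)) (EuclideanSpace.single j (1 : ℂ)) =
        (D : ℂ) • projD D ψ := by
  have h : (D : ℂ) * ((Real.sqrt D : ℂ)⁻¹ * (Real.sqrt D : ℂ)⁻¹) = 1 := by
    have h1 : (Real.sqrt D : ℂ) * Real.sqrt D = D := by
      exact_mod_cast Real.mul_self_sqrt (Nat.cast_nonneg D)
    rw [← mul_inv, h1, mul_inv_cancel₀ (by exact_mod_cast hD)]
  rw [projD_eq_rankOne, hψ]
  rw [map_smulₛₗ, map_smul, smul_apply, smul_smul, smul_smul, map_inv₀, Complex.conj_ofReal,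
    mul_assoc, h, one_smul, Finset.sum_comm]
  simp only [map_sum, sum_apply]

theorem norm_uniform (D : ℕ) (hD : D ≠ 0) (ψ : EuclideanSpace ℂ (Fin D))
    (hψ : ψ = ((Real.sqrt D : ℂ))⁻¹ • ∑ n : Fin D, EuclideanSpace.single n (1 : ℂ)) :
    ‖ψ‖ = 1 := by
  have hpos : (0 : ℝ) < D := by exact_mod_cast Nat.pos_of_ne_zero hD
  rw [hψ, norm_smul, EuclideanSpace.norm_eq]
  simp [abs_of_nonneg, hpos.ne']

theorem rankOne_smul_add_smul {E : Type*} [NormedAddCommGroup E] [InnerProductSpace ℂ E]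
    (α : ℝ) (x y : E) :
    rankOne ℂ
      ((α : ℂ) • (Complex.exp (-(Real.pi / 8 : ℝ) * Complex.I) • x +
        Complex.exp ((Real.pi / 8 : ℝ) * Complex.I) • y))
      ((α : ℂ) • (Complex.exp (-(Real.pi / 8 : ℝ) * Complex.I) • x +
        Complex.exp ((Real.pi / 8 : ℝ) * Complex.I) • y)) =
    ((α : ℂ) ^ 2) • (rankOne ℂ x x + rankOne ℂ y y +
      Complex.exp (-(Real.pi / 4 : ℝ) * Complex.I) • rankOne ℂ x y +
      Complex.exp ((Real.pi / 4 : ℝ) * Complex.I) • rankOne ℂ y x) := by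
  have h₁ : Complex.exp (-(Real.pi / 4 : ℝ) * Complex.I) =
      Complex.exp (-(Real.pi / 8 : ℝ) * Complex.I) *
        Complex.exp (-(Real.pi / 8 : ℝ) * Complex.I) := by
    rw [← Complex.exp_add]; push_cast; ring_nf
  have h₂ : Complex.exp ((Real.pi / 4 : ℝ) * Complex.I) =
      Complex.exp ((Real.pi / 8 : ℝ) * Complex.I) *
        Complex.exp ((Real.pi / 8 : ℝ) * Complex.I) := by
    rw [← Complex.exp_add]; push_cast; ring_nf
  have h₃ : Complex.exp (-(Real.pi / 8 : ℝ) * Complex.I) *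
      Complex.exp ((Real.pi / 8 : ℝ) * Complex.I) = 1 := by
    rw [← Complex.exp_add]; simp
  have h₄ : (starRingEnd ℂ) (Complex.exp (-(Real.pi / 8 : ℝ) * Complex.I)) =
      Complex.exp ((Real.pi / 8 : ℝ) * Complex.I) := by
    rw [← Complex.exp_conj, map_mul, map_neg, Complex.conj_ofReal, Complex.conj_I]
    rw [neg_mul_neg]
  have h₅ : (starRingEnd ℂ) (Complex.exp ((Real.pi / 8 : ℝ) * Complex.I)) =
      Complex.exp (-(Real.pi / 8 : ℝ) * Complex.I) := by
    rw [← Complex.exp_conj, map_mul, Complex.conj_ofReal, Complex.conj_I]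
    rw [mul_neg, neg_mul]
  simp only [map_smul, map_smulₛₗ, map_add, smul_apply, add_apply, h₁, h₂, h₄, h₅,
    Complex.conj_ofReal]
  linear_combination (norm := module) ((α : ℂ) ^ 2 * h₃) • (rankOne ℂ x x + rankOne ℂ y y)

theorem exp_add_exp_pi_div_four :
    Complex.exp (-(Real.pi / 4 : ℝ) * Complex.I) + Complex.exp ((Real.pi / 4 : ℝ) * Complex.I) =
      (Real.sqrt 2 : ℂ) := by
  have h := Complex.two_cos (Real.pi / 4 : ℝ)
  rw [add_comm, ← h, ← Complex.ofReal_cos, Real.cos_pi_div_four]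
  push_cast
  ring

/-- The normalization operator
`K(α) = (1/#H_O)∑_π U(π)|1⟩⟨1|U(π)* + (1/#H_{O'})∑_π U(π)|d_{O'}(α)⟩⟨d_{O'}(α)|U(π)*`
equals `[(2D−2−√2)α²+1](1−|ψ₀⟩⟨ψ₀|) + [(2+√2)(D−1)α²+1]|ψ₀⟩⟨ψ₀|`; in particular it is
positive and invertible. -/
theorem normalization_operator_spectral (D : ℕ) (hD : 2 ≤ D) (α : ℝ) (hα : 0 ≤ α)
    (dO' : EuclideanSpace ℂ (Fin D))
    (hdO' : dO' = (α : ℂ) •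
      (Complex.exp (-(Real.pi / 8 : ℝ) * Complex.I) •
          EuclideanSpace.single (⟨0, by omega⟩ : Fin D) (1 : ℂ) +
        Complex.exp ((Real.pi / 8 : ℝ) * Complex.I) •
          EuclideanSpace.single (⟨1, by omega⟩ : Fin D) (1 : ℂ)))
    (ψ₀ : EuclideanSpace ℂ (Fin D))
    (hψ₀ : ψ₀ = ((Real.sqrt D : ℂ))⁻¹ • ∑ n : Fin D, EuclideanSpace.single n (1 : ℂ))
    (Kα : EuclideanSpace ℂ (Fin D) →L[ℂ] EuclideanSpace ℂ (Fin D))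
    (hKα : Kα =
      (((D - 1).factorial : ℂ))⁻¹ •
        ∑ π : Equiv.Perm (Fin D),
          permU D π ∘L projD D (EuclideanSpace.single (⟨0, by omega⟩ : Fin D) (1 : ℂ))
            ∘L adjoint (permU D π) +
      (((D - 2).factorial : ℂ))⁻¹ •
        ∑ π : Equiv.Perm (Fin D),
          permU D π ∘L projD D dO' ∘L adjoint (permU D π)) :
    Kα = (((2 * (D : ℝ) - 2 - Real.sqrt 2) * α ^ 2 + 1 : ℝ) : ℂ) •
        ((1 : EuclideanSpace ℂ (Fin D) →L[ℂ] EuclideanSpace ℂ (Fin D)) - projD D ψ₀) +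
      (((2 + Real.sqrt 2) * ((D : ℝ) - 1) * α ^ 2 + 1 : ℝ) : ℂ) • projD D ψ₀ ∧
    Kα.IsPositive ∧ IsUnit Kα := by
  have hψn := norm_uniform D (by omega) ψ₀ hψ₀
  have hstar : IsStarProjection (projD D ψ₀) := isStarProjection_rankOne_self hψn
  have hform : Kα = (((2 * (D : ℝ) - 2 - Real.sqrt 2) * α ^ 2 + 1 : ℝ) : ℂ) •
        ((1 : EuclideanSpace ℂ (Fin D) →L[ℂ] EuclideanSpace ℂ (Fin D)) - projD D ψ₀) +
      (((2 + Real.sqrt 2) * ((D : ℝ) - 1) * α ^ 2 + 1 : ℝ) : ℂ) • projD D ψ₀ := by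
    obtain ⟨n, rfl⟩ := Nat.exists_eq_add_of_le' hD
    have hfac : (n.factorial : ℂ) ≠ 0 := by exact_mod_cast n.factorial_ne_zero
    have hfac' : ((n + 1).factorial : ℂ) ≠ 0 := by exact_mod_cast (n + 1).factorial_ne_zero
    have hsum := rankOne_sum_single (n + 2) (by omega) ψ₀ hψ₀
    have hsum' := hsum
    rw [Finset.sum_comm] at hsum'
    have h0 : (⟨0, by omega⟩ : Fin (n + 2)) = 0 := rfl
    have h1 : (⟨1, by omega⟩ : Fin (n + 2)) = 1 := rfl
    have hU (π : Equiv.Perm (Fin (n + 2))) : permU (n + 2) π dO' = (α : ℂ) •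
        (Complex.exp (-(Real.pi / 8 : ℝ) * Complex.I) • EuclideanSpace.single (π 0) (1 : ℂ) +
          Complex.exp ((Real.pi / 8 : ℝ) * Complex.I) • EuclideanSpace.single (π 1) (1 : ℂ)) := by
      rw [hdO']
      simp only [map_smul, map_add, permU_single, h0, h1]
    rw [hKα]
    simp only [permU_conj_projD, permU_single, hU, rankOne_smul_add_smul, h0]
    rw [sum_perm_apply_zero (n + 1) fun i => rankOne ℂ (EuclideanSpace.single i (1 : ℂ))
        (EuclideanSpace.single i (1 : ℂ)),
      sum_perm_apply_zero_one n fun i j => ((α : ℂ) ^ 2) •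
        (rankOne ℂ (EuclideanSpace.single i (1 : ℂ)) (EuclideanSpace.single i (1 : ℂ)) +
          rankOne ℂ (EuclideanSpace.single j (1 : ℂ)) (EuclideanSpace.single j (1 : ℂ)) +
          Complex.exp (-(Real.pi / 4 : ℝ) * Complex.I) •
            rankOne ℂ (EuclideanSpace.single i (1 : ℂ)) (EuclideanSpace.single j (1 : ℂ)) +
          Complex.exp ((Real.pi / 4 : ℝ) * Complex.I) •
            rankOne ℂ (EuclideanSpace.single j (1 : ℂ)) (EuclideanSpace.single i (1 : ℂ)))]
    simp only [← Finset.smul_sum, Finset.sum_add_distrib, sum_rankOne_single, hsum, hsum',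
      Finset.sum_const, Finset.card_univ, Fintype.card_fin]
    rw [show n + 2 - 1 = n + 1 from rfl, show n + 2 - 2 = n from rfl,
      ← Nat.cast_smul_eq_nsmul ℂ (n + 1).factorial, ← Nat.cast_smul_eq_nsmul ℂ n.factorial,
      inv_smul_smul₀ hfac, inv_smul_smul₀ hfac', ← Nat.cast_smul_eq_nsmul ℂ (n + 2)]
    push_cast
    rw [← exp_add_exp_pi_div_four]
    module
  have hD' : (2 : ℝ) ≤ D := by exact_mod_cast hD
  have hsqrt : Real.sqrt 2 < 2 := by
    rw [Real.sqrt_lt' (by norm_num)]; norm_num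
  have ha : 0 < (2 * (D : ℝ) - 2 - Real.sqrt 2) * α ^ 2 + 1 := by
    have : 0 ≤ 2 * (D : ℝ) - 2 - Real.sqrt 2 := by linarith
    positivity
  have hb : 0 < (2 + Real.sqrt 2) * ((D : ℝ) - 1) * α ^ 2 + 1 := by
    have : 0 ≤ (D : ℝ) - 1 := by linarith
    positivity
  refine ⟨hform, ?_⟩
  rw [hform]
  exact isPositive_and_isUnit_of_isStarProjection hstar ha hb
end
end
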